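/- arXiv:1807.11645 — 6 statements merged into one kernel-verified Lean document; each statement's English description precedes it below -/
import Mathlib

section
/- Let f ∈ K[X] have degree d ≥ 2 and let ℓ_1, ℓ_2 ∈ ℚ̄[X] be linear polynomials. If f ∘ f = ℓ_1 ∘ X^{d²} ∘ ℓ_2 (i.e. the second iterate of f equals ℓ_1(ℓ_2(X)^{d²})), then there exists a linear polynomial ℓ ∈ ℚ̄[X] such that f = ℓ ∘ X^d ∘ ℓ^{−1}. -/
open Polynomial

/-- A complex polynomial of degree `n + 1` whose derivative divides a power of `X - γ` is
`a (X - γ) ^ (n + 1) + b`. -/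
theorem Polynomial.eq_C_mul_X_sub_C_pow_add_C_of_derivative_dvd {f : ℂ[X]} {γ : ℂ} {n m : ℕ}
    (hdeg : f.natDegree = n + 1) (hdvd : derivative f ∣ (X - C γ) ^ m) :
    f = C f.leadingCoeff * (X - C γ) ^ (n + 1) + C (f.eval γ) := by
  obtain ⟨i, -, hi⟩ := (dvd_prime_pow (prime_X_sub_C γ) m).1 hdvd
  obtain ⟨u, hu⟩ := hi.symm
  obtain ⟨c, -, hc⟩ := Polynomial.isUnit_iff.1 u.isUnit
  rw [← hc] at hu
  have hf' : (derivative f).natDegree = n := by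
    rw [natDegree_derivative, hdeg, Nat.add_sub_cancel]
  have hc0 : c ≠ 0 := by
    rintro rfl
    rw [map_zero] at hc
    exact u.ne_zero hc.symm
  have hin : i = n := by
    rw [← hf', ← hu, natDegree_mul_C hc0, natDegree_pow, natDegree_X_sub_C, mul_one]
  subst hin
  have hn : ((i : ℂ) + 1) ≠ 0 := by exact_mod_cast Nat.succ_ne_zero i
  have hder : derivative (f - C (c / (i + 1)) * (X - C γ) ^ (i + 1)) = 0 := by
    have hC : C (c / ((i : ℂ) + 1)) * C ((i : ℂ) + 1) = C c := by
      rw [← C_mul, div_mul_cancel₀ _ hn]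
    rw [derivative_sub, ← hu, derivative_C_mul, derivative_X_sub_C_pow, ← hC]
    push_cast
    ring
  obtain ⟨b, hb⟩ := natDegree_eq_zero.1 (derivative_eq_zero.1 hder)
  have hf : f = C (c / (i + 1)) * (X - C γ) ^ (i + 1) + C b := by rw [hb]; ring
  have hlead : f.leadingCoeff = c / (i + 1) := by
    have hmonic : ((X - C γ) ^ (i + 1)).coeff (i + 1) = 1 := by
      simpa using ((monic_X_sub_C γ).pow (i + 1)).coeff_natDegree
    rw [leadingCoeff, hdeg, hf, coeff_add, coeff_C_mul, hmonic, coeff_C_succ, mul_one, add_zero]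
  have heval : f.eval γ = b := by rw [hf]; simp
  rw [hlead, heval]
  exact hf

/-- If the derivative of `f ∘ f` is a constant multiple of a power of `X - γ`, then
`f = a (X - γ) ^ deg f + γ`. -/
theorem Polynomial.eq_of_derivative_comp_self {f : ℂ[X]} {γ e : ℂ} {n m : ℕ} (he : e ≠ 0)
    (hn : n ≠ 0) (hdeg : f.natDegree = n + 1)
    (h : derivative (f.comp f) = C e * (X - C γ) ^ m) :
    f = C f.leadingCoeff * (X - C γ) ^ (n + 1) + C γ := by
  rw [derivative_comp] at h
  have hdvd : derivative f ∣ (X - C γ) ^ m := by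
    have hdvd' : derivative f ∣ C e * (X - C γ) ^ m := ⟨_, h.symm⟩
    exact ((isUnit_C.2 he.isUnit).dvd_mul_left).1 hdvd'
  have hf := eq_C_mul_X_sub_C_pow_add_C_of_derivative_dvd hdeg hdvd
  have hf'γ : (derivative f).eval γ = 0 := by
    rw [hf]
    simp [derivative_X_sub_C_pow, hn]
  have hdegγ : (f - C γ).degree ≠ 0 := by
    intro h0
    have := natDegree_eq_zero_iff_degree_le_zero.2 h0.le
    rw [natDegree_sub_C, hdeg] at this
    omega
  obtain ⟨x, hx⟩ := IsAlgClosed.exists_root (f - C γ) hdegγ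
  have hfx : f.eval x = γ := by simpa [sub_eq_zero] using hx
  have hxγ : x = γ := by
    have hev := congrArg (eval x) h
    simp only [eval_mul, eval_comp, hfx, hf'γ, mul_zero, eval_C, eval_pow, eval_sub, eval_X]
      at hev
    exact sub_eq_zero.1 (eq_zero_of_pow_eq_zero ((mul_eq_zero.1 hev.symm).resolve_left he))
  rw [← hxγ, hfx] at hf
  rwa [hxγ] at hf

/-- If `f ∈ K[X]` has degree `d ≥ 2` and its second iterate satisfies
`f ∘ f = ℓ₁ ∘ X^{d²} ∘ ℓ₂` for some linear `ℓ₁, ℓ₂ ∈ ℚ̄[X]`, then there is a linear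
`ℓ ∈ ℚ̄[X]` with `f = ℓ ∘ X^d ∘ ℓ⁻¹`. -/
theorem statement_4 (K : Subfield ℂ) [FiniteDimensional ℚ K]
    (f : Polynomial ℂ) (hcoeff : ∀ n, f.coeff n ∈ K)
    (d : ℕ) (hd : 2 ≤ d) (hdf : f.natDegree = d)
    (l1 l2 : Polynomial ℂ) (hl1 : l1.degree = 1) (hl2 : l2.degree = 1)
    (hl1a : ∀ n, IsAlgebraic ℚ (l1.coeff n)) (hl2a : ∀ n, IsAlgebraic ℚ (l2.coeff n))
    (h : f.comp f = (l1.comp (Polynomial.X ^ d ^ 2)).comp l2) :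
    ∃ l linv : Polynomial ℂ, l.degree = 1 ∧ (∀ n, IsAlgebraic ℚ (l.coeff n)) ∧
      l.comp linv = Polynomial.X ∧ linv.comp l = Polynomial.X ∧
      f = (l.comp (Polynomial.X ^ d)).comp linv := by
  have : Algebra.IsAlgebraic ℚ K := Algebra.IsAlgebraic.of_finite ℚ K
  obtain ⟨n, rfl⟩ : ∃ n, d = n + 1 := ⟨d - 1, by omega⟩
  have hn : n ≠ 0 := by omega
  have hA : l1.coeff 1 ≠ 0 := coeff_ne_zero_of_eq_degree hl1
  have hB : l2.coeff 1 ≠ 0 := coeff_ne_zero_of_eq_degree hl2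
  have e1 := eq_X_add_C_of_degree_le_one hl1.le
  have e2 := eq_X_add_C_of_degree_le_one hl2.le
  set A := l1.coeff 1
  set B := l2.coeff 1
  set D := l2.coeff 0
  set γ := -D / B with hγ
  have hγa : IsAlgebraic ℚ γ := by
    rw [hγ, div_eq_mul_inv]
    exact (hl2a 0).neg.mul (hl2a 1).inv
  have e2' : l2 = C B * (X - C γ) := by
    have hBγ : B * γ = -D := by rw [hγ]; field_simp
    rw [mul_sub, ← C_mul, hBγ, C_neg, sub_neg_eq_add]
    exact e2
  have hder : derivative (f.comp f) =
      C (A * B ^ ((n + 1) ^ 2) * ((n + 1) ^ 2 : ℕ)) * (X - C γ) ^ ((n + 1) ^ 2 - 1) := by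
    rw [h, e1, e2']
    simp only [add_comp, mul_comp, C_comp, X_comp, pow_comp, derivative_add, derivative_C, mul_pow,
      ← C_pow, derivative_C_mul, derivative_X_sub_C_pow, C_mul, add_zero, C_eq_natCast]
    ring
  have hne : A * B ^ ((n + 1) ^ 2) * ((n + 1) ^ 2 : ℕ) ≠ 0 :=
    mul_ne_zero (mul_ne_zero hA (pow_ne_zero _ hB))
      (Nat.cast_ne_zero.2 (pow_ne_zero 2 n.succ_ne_zero))
  have hf := eq_of_derivative_comp_self hne hn hdf hder
  have haa : IsAlgebraic ℚ f.leadingCoeff :=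
    (Algebra.IsAlgebraic.isAlgebraic (R := ℚ) (⟨_, hcoeff f.natDegree⟩ : K)).algebraMap (A := ℂ)
  have ha0 : f.leadingCoeff ≠ 0 := by
    rw [Ne, leadingCoeff_eq_zero]
    rintro rfl
    simp at hdf
  set a := f.leadingCoeff
  obtain ⟨α, hα⟩ := IsAlgClosed.exists_pow_nat_eq a⁻¹ (Nat.pos_of_ne_zero hn)
  have hα0 : α ≠ 0 := by
    rintro rfl
    rw [zero_pow hn] at hα
    exact inv_ne_zero ha0 hα.symm
  have hαa : IsAlgebraic ℚ α :=
    IsAlgebraic.of_pow (Nat.pos_of_ne_zero hn) (by rw [hα]; exact haa.inv)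
  have hC : C α * C α⁻¹ = (1 : ℂ[X]) := by rw [← C_mul, mul_inv_cancel₀ hα0, C_1]
  refine ⟨C α * X + C γ, C α⁻¹ * (X - C γ), degree_linear hα0, ?_, ?_, ?_, ?_⟩
  · rintro (_ | _ | k)
    · simpa using hγa
    · simpa [coeff_C] using hαa
    · simpa [coeff_C, coeff_X] using isAlgebraic_zero
  · simp only [add_comp, mul_comp, C_comp, X_comp]
    linear_combination (X - C γ) * hC
  · simp only [sub_comp, mul_comp, C_comp, X_comp]
    linear_combination X * hC
  · have ha : a = α * α⁻¹ ^ (n + 1) := by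
      rw [inv_pow, pow_succ, hα]
      field_simp
    simp only [add_comp, mul_comp, C_comp, X_comp, pow_comp, mul_pow]
    rw [← mul_assoc, ← C_pow, ← C_mul, ← ha]
    exact hf
end

section
/- Let f_i = a_{i,d_i}X^{d_i} + a_{i,d_i−1}X^{d_i−1} + ⋯ + a_{i,0} ∈ K[X] be polynomials of degrees d_i ≥ 2 for i = 1,…,s, and let |·|_v be a non-archimedean absolute value of K extended to ℚ̄. Suppose α ∈ ℚ̄ satisfies |α|_v > max over i = 1,…,s and j = 0,…,d_i−1 of { 1, |a_{i,j}|_v |a_{i,d_i}|_v^{−1}, |a_{i,d_i}|_v^{−1} }. Then for every n ≥ 1 and all indices i_1,…,i_n ∈ {1,…,s}, one has |f_{i_1…i_n}(α)|_v > |f_{i_1…i_{n−1}}(α)|_v. -/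
open Polynomial

/-- `compWord f [i₁, …, i_k] = f i_k ∘ ⋯ ∘ f i₁` (and `X` for the empty word), so that
`(compWord f [i₁, …, i_k]).eval α = f_{i₁…i_k}(α)`. -/
noncomputable def compWord {s : ℕ} (f : Fin s → Polynomial ℂ) : List (Fin s) → Polynomial ℂ
  | [] => Polynomial.X
  | i :: w => (compWord f w).comp (f i)

/-- Outside the disc given by the coefficient bounds, the leading term of a polynomial
dominates for a nonarchimedean absolute value. -/
theorem nonarchimedean_eval_eq_leading_term {F : Type*} [Field F] {v : AbsoluteValue F ℝ}
    (hv : IsNonarchimedean ⇑v) {p : F[X]} (hp : p ≠ 0) {x : F} (hx : 1 < v x)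
    (hcoeff : ∀ j < p.natDegree, v (p.coeff j) * (v p.leadingCoeff)⁻¹ < v x) :
    v (p.eval x) = v p.leadingCoeff * v x ^ p.natDegree := by
  have hlead : 0 < v p.leadingCoeff := v.pos (leadingCoeff_ne_zero.mpr hp)
  have hx0 : 0 < v x := zero_lt_one.trans hx
  have hlower : v (∑ j ∈ Finset.range p.natDegree, p.coeff j * x ^ j) <
      v (p.coeff p.natDegree * x ^ p.natDegree) := by
    rw [map_mul, map_pow, coeff_natDegree]
    refine Finset.sum_induction _ (fun y ↦ v y < v p.leadingCoeff * v x ^ p.natDegree)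
      (fun a b ha hb ↦ (hv a b).trans_lt (max_lt ha hb)) (by rw [map_zero]; positivity) ?_
    intro j hj
    have hj := Finset.mem_range.mp hj
    have hcj : v (p.coeff j) < v x * v p.leadingCoeff := by
      simpa only [← div_eq_mul_inv, div_lt_iff₀ hlead] using hcoeff j hj
    calc
      v (p.coeff j * x ^ j) = v (p.coeff j) * v x ^ j := by rw [map_mul, map_pow]
      _ < v x * v p.leadingCoeff * v x ^ j := by gcongr
      _ = v p.leadingCoeff * v x ^ (j + 1) := by ring
      _ ≤ v p.leadingCoeff * v x ^ p.natDegree := by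
        gcongr
        · exact hx.le
        · exact hj
  rw [eval_eq_sum_range, Finset.sum_range_succ,
    IsNonarchimedean.add_eq_right_of_lt hv hlower, map_mul, map_pow, coeff_natDegree]

/-- A polynomial of degree at least two strictly increases a nonarchimedean absolute value
outside the disc given by the bounds on its coefficients. -/
theorem nonarchimedean_lt_eval {F : Type*} [Field F] {v : AbsoluteValue F ℝ}
    (hv : IsNonarchimedean ⇑v) {p : F[X]} (hdeg : 2 ≤ p.natDegree) {x : F} (hx : 1 < v x)
    (hlead : (v p.leadingCoeff)⁻¹ < v x)
    (hcoeff : ∀ j < p.natDegree, v (p.coeff j) * (v p.leadingCoeff)⁻¹ < v x) :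
    v x < v (p.eval x) := by
  have hp : p ≠ 0 := by
    rintro rfl
    simp at hdeg
  have hpos : 0 < v p.leadingCoeff := v.pos (leadingCoeff_ne_zero.mpr hp)
  have hx0 : 0 < v x := zero_lt_one.trans hx
  rw [nonarchimedean_eval_eq_leading_term hv hp hx hcoeff]
  calc
    v x = 1 * v x := (one_mul _).symm
    _ < v p.leadingCoeff * v x * v x := by
      gcongr
      exact (inv_lt_iff_one_lt_mul₀' hpos).mp hlead
    _ = v p.leadingCoeff * v x ^ 2 := by ring
    _ ≤ v p.leadingCoeff * v x ^ p.natDegree := by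
      gcongr
      exact hx.le

/-- Appending a letter to a composition word strictly increases its nonarchimedean value
outside the disc given by the coefficient bounds of all the polynomials. -/
theorem compWord_eval_lt_eval_append {s : ℕ} {f : Fin s → ℂ[X]}
    (hdeg : ∀ i, 2 ≤ (f i).natDegree) {v : AbsoluteValue ℂ ℝ} (hv : IsNonarchimedean ⇑v)
    {x : ℂ} (hx : 1 < v x) (hlead : ∀ i, (v (f i).leadingCoeff)⁻¹ < v x)
    (hcoeff : ∀ i, ∀ j < (f i).natDegree,
      v ((f i).coeff j) * (v (f i).leadingCoeff)⁻¹ < v x) (w : List (Fin s)) (i : Fin s) :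
    v ((compWord f w).eval x) < v ((compWord f (w ++ [i])).eval x) := by
  have hstep (k : Fin s) : v x < v ((f k).eval x) :=
    nonarchimedean_lt_eval hv (hdeg k) hx (hlead k) (hcoeff k)
  induction w generalizing x with
  | nil => simpa [compWord] using hstep i
  | cons k w ih =>
    have hlead' (l : Fin s) := (hlead l).trans (hstep k)
    have hcoeff' (l : Fin s) (j : ℕ) (hj : j < (f l).natDegree) :=
      (hcoeff l j hj).trans (hstep k)
    have hx' := hx.trans (hstep k)
    simpa only [List.cons_append, compWord, eval_comp] using
      ih hx' hlead' hcoeff' fun l ↦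
        nonarchimedean_lt_eval hv (hdeg l) hx' (hlead' l) (hcoeff' l)

/-- If `|α|_v` exceeds `1`, `|a_{i,j}|_v |a_{i,d_i}|_v⁻¹` and
`|a_{i,d_i}|_v⁻¹` for all `i` and `j < d_i` (for a non-archimedean absolute value `|·|_v`
of `K` extended to `ℚ̄`), then `|f_{i₁…i_n}(α)|_v > |f_{i₁…i_{n-1}}(α)|_v` for all `n ≥ 1`
and all indices. -/
theorem statement_6 (K : Subfield ℂ) [FiniteDimensional ℚ K]
    {s : ℕ} (f : Fin s → Polynomial ℂ)
    (hcoeff : ∀ i n, (f i).coeff n ∈ K)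
    (hdeg : ∀ i, 2 ≤ (f i).natDegree)
    (v : AbsoluteValue ℂ ℝ) (hv : IsNonarchimedean ⇑v)
    (α : ℂ) (halg : IsAlgebraic ℚ α)
    (h1 : 1 < v α)
    (h2 : ∀ i, (v ((f i).leadingCoeff))⁻¹ < v α)
    (h3 : ∀ i, ∀ j < (f i).natDegree,
      v ((f i).coeff j) * (v ((f i).leadingCoeff))⁻¹ < v α) :
    ∀ (w : List (Fin s)) (i : Fin s),
      v ((compWord f w).eval α) < v ((compWord f (w ++ [i])).eval α) :=
  compWord_eval_lt_eval_append hdeg hv h1 h2 h3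
end

section
/- Let f_1,…,f_s ∈ K^c[X] be polynomials of degrees ≥ 2. Then there exists a positive integer D, depending only on f_1,…,f_s, such that for every n ≥ 1, all indices i_1,…,i_n ∈ {1,…,s} and every α ∈ K^c: if f_{i_1…i_n}(α) is an algebraic integer, then Dα is an algebraic integer and D · f_{i_1…i_r}(α) is an algebraic integer for every r = 1,…,n−1. -/
open Polynomial

/-- The cyclotomic closure `K^c = K(𝕌)`: the subfield of `ℂ` generated by `K`
and all roots of unity. -/
noncomputable def cycClosure (K : Subfield ℂ) : Subfield ℂ :=
  Subfield.closure ((K : Set ℂ) ∪ {z : ℂ | ∃ n : ℕ, 0 < n ∧ z ^ n = 1})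

theorem isAlgebraic_of_mem_cycClosure (K : Subfield ℂ) [FiniteDimensional ℚ K] {z : ℂ}
    (hz : z ∈ cycClosure K) : IsAlgebraic ℤ z := by
  have h : cycClosure K ≤ (algebraicClosure ℚ ℂ).toSubfield := by
    refine Subfield.closure_le.2 ?_
    rintro x (hx | ⟨n, hn, hx⟩)
    · have : IsIntegral ℚ (⟨x, hx⟩ : K) := Algebra.IsIntegral.isIntegral _
      exact mem_algebraicClosure_iff.2 (this.map (IsScalarTower.toAlgHom ℚ K ℂ)).isAlgebraic
    · have : IsIntegral ℚ x := IsIntegral.of_pow hn (hx ▸ isIntegral_one)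
      exact mem_algebraicClosure_iff.2 this.isAlgebraic
  exact (IsFractionRing.isAlgebraic_iff ℤ ℚ ℂ).2 (mem_algebraicClosure_iff.1 (h hz))

theorem isIntegral_of_monic_of_isIntegral_coeff {g : Polynomial ℂ} (hg : g.Monic)
    (hd : g.natDegree ≠ 0) (hc : ∀ j, IsIntegral ℤ (g.coeff j)) {y : ℂ}
    (hy : IsIntegral ℤ (g.eval y)) : IsIntegral ℤ y := by
  let O := integralClosure ℤ ℂ
  have hl : g ∈ Polynomial.lifts (algebraMap O ℂ) :=
    (Polynomial.lifts_iff_coeff_lifts g).2 fun j => ⟨⟨g.coeff j, hc j⟩, rfl⟩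
  obtain ⟨p, hp, hpd, hpm⟩ := Polynomial.lifts_and_natDegree_eq_and_monic hl hg
  refine isIntegral_trans (A := O) y (IsIntegral.of_aeval_monic hpm (hpd ▸ hd) ?_)
  rw [← Polynomial.eval_map_algebraMap, hp]
  exact hy.tower_top

theorem isIntegral_natCast_mul_of_eval {p : Polynomial ℂ} (hdeg : 2 ≤ p.natDegree) {D : ℕ}
    (hlead : IsIntegral ℤ ((D : ℂ) * p.leadingCoeff⁻¹))
    (hcoeff : ∀ j, IsIntegral ℤ ((D : ℂ) * (p.leadingCoeff⁻¹ * p.coeff j))) {x : ℂ}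
    (hx : IsIntegral ℤ ((D : ℂ) * p.eval x)) : IsIntegral ℤ ((D : ℂ) * x) := by
  have hp : p.leadingCoeff ≠ 0 := by
    rw [Polynomial.leadingCoeff_ne_zero]
    rintro rfl
    simp at hdeg
  have hD : IsIntegral ℤ (D : ℂ) := isIntegral_algebraMap (R := ℤ) (x := D)
  have hnat : (C p.leadingCoeff⁻¹ * p.scaleRoots (D : ℂ)).natDegree = p.natDegree := by
    rw [Polynomial.natDegree_C_mul (inv_ne_zero hp), Polynomial.natDegree_scaleRoots]
  have hmonic : (C p.leadingCoeff⁻¹ * p.scaleRoots (D : ℂ)).Monic := by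
    rw [Polynomial.Monic, Polynomial.leadingCoeff, hnat, Polynomial.coeff_C_mul,
      Polynomial.coeff_scaleRoots_natDegree, inv_mul_cancel₀ hp]
  refine isIntegral_of_monic_of_isIntegral_coeff hmonic (by omega) (fun j => ?_) ?_
  · rcases lt_trichotomy j p.natDegree with hj | rfl | hj
    · obtain ⟨k, hk⟩ := Nat.exists_eq_add_of_lt hj
      have : p.natDegree - j = k + 1 := by omega
      rw [Polynomial.coeff_C_mul, Polynomial.coeff_scaleRoots, this]
      refine (congrArg (IsIntegral ℤ) ?_).mp ((hcoeff j).mul (hD.pow k))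
      ring
    · rw [Polynomial.coeff_C_mul, Polynomial.coeff_scaleRoots_natDegree, inv_mul_cancel₀ hp]
      exact isIntegral_one
    · rw [Polynomial.coeff_eq_zero_of_natDegree_lt (hnat.trans_lt hj)]
      exact isIntegral_zero
  · obtain ⟨k, hk⟩ := Nat.exists_eq_add_of_le hdeg
    have : (p.scaleRoots (D : ℂ)).eval ((D : ℂ) * x) = (D : ℂ) ^ p.natDegree * p.eval x := by
      simpa using Polynomial.scaleRoots_eval₂_mul (p := p) (RingHom.id ℂ) x (D : ℂ)
    rw [Polynomial.eval_mul, Polynomial.eval_C, this, hk]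
    refine (congrArg (IsIntegral ℤ) ?_).mp ((hlead.mul hx).mul (hD.pow k))
    ring

theorem exists_natCast_mul_isIntegral (t : Finset ℂ) (ht : ∀ x ∈ t, IsAlgebraic ℤ x) :
    ∃ D : ℕ, 0 < D ∧ ∀ x ∈ t, IsIntegral ℤ ((D : ℂ) * x) := by
  induction t using Finset.induction_on with
  | empty => exact ⟨1, one_pos, by simp⟩
  | insert a t _ ih =>
    obtain ⟨D, hD, h⟩ := ih fun x hx => ht x (Finset.mem_insert_of_mem hx)
    obtain ⟨y, hy, hya⟩ := (ht a (Finset.mem_insert_self a t)).exists_integral_multiple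
    have hint : ∀ m : ℤ, IsIntegral ℤ (m : ℂ) := fun m => isIntegral_algebraMap (R := ℤ) (x := m)
    have hcast : ((D * y.natAbs ^ 2 : ℕ) : ℂ) = D * (y : ℂ) ^ 2 := by
      rw [← Int.cast_natCast (R := ℂ), Nat.cast_mul, Nat.cast_pow, Int.natAbs_sq]
      push_cast
      rfl
    refine ⟨D * y.natAbs ^ 2, Nat.mul_pos hD (pow_pos (Int.natAbs_pos.2 hy) 2), fun x hx => ?_⟩
    rw [hcast]
    rcases Finset.mem_insert.1 hx with rfl | hx
    · refine (congrArg (IsIntegral ℤ) ?_).mp ((hint (D * y)).mul hya)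
      rw [zsmul_eq_mul]
      push_cast
      ring
    · refine (congrArg (IsIntegral ℤ) ?_).mp ((hint (y ^ 2)).mul (h x hx))
      push_cast
      ring

theorem isIntegral_mul_eval_compWord_take {s : ℕ} {f : Fin s → Polynomial ℂ} {c : ℂ}
    (h : ∀ i x, IsIntegral ℤ (c * (f i).eval x) → IsIntegral ℤ (c * x)) (w : List (Fin s)) :
    ∀ α : ℂ, IsIntegral ℤ (c * (compWord f w).eval α) →
      ∀ r : ℕ, IsIntegral ℤ (c * (compWord f (w.take r)).eval α) := by
  induction w with
  | nil => intro α hα r; simpa using hα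
  | cons i w ih =>
    intro α hα r
    simp only [compWord, Polynomial.eval_comp] at hα
    have hw := ih _ hα
    cases r with
    | zero => simpa [compWord] using h i α (by simpa [compWord] using hw 0)
    | succ r => simpa [compWord] using hw r

/-- For `f_1,…,f_s ∈ K^c[X]` of degrees `≥ 2` there exists a positive
integer `D`, depending only on `f_1,…,f_s`, such that whenever `f_{i₁…i_n}(α)` is an
algebraic integer for some `α ∈ K^c` and `n ≥ 1`, both `Dα` and all
`D·f_{i₁…i_r}(α)`, `r = 1,…,n-1`, are algebraic integers. -/
theorem statement_10 (K : Subfield ℂ) [FiniteDimensional ℚ K]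
    {s : ℕ} (f : Fin s → Polynomial ℂ)
    (hcoeff : ∀ i n, (f i).coeff n ∈ cycClosure K)
    (hdeg : ∀ i, 2 ≤ (f i).natDegree) :
    ∃ D : ℕ, 0 < D ∧ ∀ w : List (Fin s), 1 ≤ w.length →
      ∀ α : ℂ, α ∈ cycClosure K → IsIntegral ℤ ((compWord f w).eval α) →
        IsIntegral ℤ ((D : ℂ) * α) ∧
        ∀ r : ℕ, 1 ≤ r → r < w.length →
          IsIntegral ℤ ((D : ℂ) * (compWord f (w.take r)).eval α) := by
  have hmem : ∀ i, (f i).leadingCoeff⁻¹ ∈ cycClosure K := fun i => inv_mem (hcoeff i _)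
  let t : Finset ℂ := Finset.univ.biUnion fun i =>
    insert (f i).leadingCoeff⁻¹
      ((f i).support.image fun j => (f i).leadingCoeff⁻¹ * (f i).coeff j)
  obtain ⟨D, hD, hDt⟩ := exists_natCast_mul_isIntegral t (by
    intro x hx
    refine isAlgebraic_of_mem_cycClosure K ?_
    simp only [t, Finset.mem_biUnion, Finset.mem_insert, Finset.mem_image] at hx
    obtain ⟨i, -, rfl | ⟨j, -, rfl⟩⟩ := hx
    · exact hmem i
    · exact mul_mem (hmem i) (hcoeff i j))
  have hstep : ∀ i x, IsIntegral ℤ ((D : ℂ) * (f i).eval x) → IsIntegral ℤ ((D : ℂ) * x) := by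
    refine fun i x => isIntegral_natCast_mul_of_eval (hdeg i) (hDt _ ?_) fun j => ?_
    · exact Finset.mem_biUnion.2 ⟨i, Finset.mem_univ i, Finset.mem_insert_self _ _⟩
    · by_cases hj : (f i).coeff j = 0
      · simpa [hj] using isIntegral_zero
      · exact hDt _ (Finset.mem_biUnion.2 ⟨i, Finset.mem_univ i, Finset.mem_insert_of_mem
          (Finset.mem_image_of_mem _ (Polynomial.mem_support_iff.2 hj))⟩)
  refine ⟨D, hD, fun w _ α _ hα => ?_⟩
  have hw := isIntegral_mul_eval_compWord_take hstep w α
    ((isIntegral_algebraMap (R := ℤ) (x := D)).mul hα)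
  exact ⟨by simpa [compWord] using hw 0, fun r _ _ => hw r⟩
end

section
/- Let f ∈ ℚ̄[X] have degree d ≥ 1, let m ≥ 1 be an integer, and suppose S(X) = a_1X^{m} + b_1X^{−m} + c_1 with a_1b_1 ≠ 0 is a Laurent polynomial over ℚ̄ such that f(S(X)) = a_2X^{dm} + b_2X^{−dm} + c_2 for some a_2, b_2, c_2 ∈ ℚ̄. Then there exist linear polynomials L_1, L_2 ∈ ℚ̄[X] such that f ∘ L_1 = L_2 ∘ T_d; explicitly, with u ∈ ℚ̄ a square root of a_1b_1^{−1}, one may take L_1(X) = a_1u^{−1}X + c_1 and L_2(X) = a_2u^{−d}X + c_2. -/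
open Polynomial in
/-- Over an algebraically closed field, a polynomial identity can be checked on the values
`z + z⁻¹` with `z ≠ 0`. -/
theorem Polynomial.eq_of_eval_add_inv_eq {K : Type*} [Field K] [IsAlgClosed K]
    {p q : K[X]} (h : ∀ z : K, z ≠ 0 → p.eval (z + z⁻¹) = q.eval (z + z⁻¹)) : p = q := by
  refine Polynomial.funext fun w => ?_
  obtain ⟨z, hz⟩ := IsAlgClosed.exists_root (X ^ 2 - C w * X + 1 : K[X]) (by
    have : (X ^ 2 - C w * X + 1 : K[X]).degree = 2 := by compute_degree!
    simp [this])
  have hz' : z ^ 2 - w * z + 1 = 0 := by simpa [IsRoot] using hz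
  have hz0 : z ≠ 0 := by
    rintro rfl
    simp at hz'
  have hw : w = z + z⁻¹ := by
    field_simp
    linear_combination -hz'
  rw [hw]
  exact h z hz0

open LaurentPolynomial in
/-- If `p` maps one Laurent trinomial `a₁ X ^ m + b₁ X ^ (-m) + c₁` to another such trinomial
of exponent `d * m`, then this holds for the values at every `y`, with `X ^ m` replaced by `y`. -/
theorem LaurentPolynomial.eval_trinomial_of_aeval_eq {K : Type*} [Field K] [IsAlgClosed K]
    {p : Polynomial K} {d m : ℕ} (hm : m ≠ 0) {a₁ b₁ c₁ a₂ b₂ c₂ : K}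
    (h : Polynomial.aeval (C a₁ * T (m : ℤ) + C b₁ * T (-(m : ℤ)) + C c₁) p =
      C a₂ * T ((d * m : ℕ) : ℤ) + C b₂ * T (-((d * m : ℕ) : ℤ)) + C c₂)
    {y : K} (hy : y ≠ 0) :
    p.eval (a₁ * y + b₁ * y⁻¹ + c₁) = a₂ * y ^ d + b₂ * (y ^ d)⁻¹ + c₂ := by
  obtain ⟨x, rfl⟩ := IsAlgClosed.exists_pow_nat_eq y (Nat.pos_of_ne_zero hm)
  have hx : x ≠ 0 := fun hx => hy (by rw [hx, zero_pow hm])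
  have h' := congrArg (eval₂ (RingHom.id K) (Units.mk0 x hx)) h
  rw [Polynomial.aeval_def, Polynomial.hom_eval₂] at h'
  have hC : (eval₂ (RingHom.id K) (Units.mk0 x hx)).comp (algebraMap K K[T;T⁻¹]) =
      RingHom.id K := by
    ext r
    simp
  rw [hC, mul_comm d m] at h'
  simpa [zpow_mul] using h'

/-- If `f ∈ ℚ̄[X]` has degree `d ≥ 1` and
`f(a₁X^m + b₁X^{-m} + c₁) = a₂X^{dm} + b₂X^{-dm} + c₂` with `a₁b₁ ≠ 0`, then for a square
root `u` of `a₁b₁⁻¹` one has `f ∘ L₁ = L₂ ∘ T_d`, where `L₁(X) = a₁u⁻¹X + c₁` and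
`L₂(X) = a₂u^{-d}X + c₂`.  (Here `T_d`, determined by `T_d(x + x⁻¹) = x^d + x^{-d}`, is
`Polynomial.dickson 1 1 d`.) -/
theorem statement_12
    (f : Polynomial (AlgebraicClosure ℚ)) (d : ℕ) (hd : 1 ≤ d) (hdf : f.natDegree = d)
    (m : ℕ) (hm : 1 ≤ m)
    (a1 b1 c1 a2 b2 c2 : AlgebraicClosure ℚ) (hab : a1 * b1 ≠ 0)
    (h : Polynomial.aeval
        (LaurentPolynomial.C a1 * LaurentPolynomial.T (m : ℤ) +
          LaurentPolynomial.C b1 * LaurentPolynomial.T (-(m : ℤ)) +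
          LaurentPolynomial.C c1) f =
      LaurentPolynomial.C a2 * LaurentPolynomial.T ((d * m : ℕ) : ℤ) +
        LaurentPolynomial.C b2 * LaurentPolynomial.T (-((d * m : ℕ) : ℤ)) +
        LaurentPolynomial.C c2) :
    ∃ u : AlgebraicClosure ℚ, u ^ 2 = a1 * b1⁻¹ ∧
      f.comp (Polynomial.C (a1 * u⁻¹) * Polynomial.X + Polynomial.C c1) =
        (Polynomial.C (a2 * u⁻¹ ^ d) * Polynomial.X + Polynomial.C c2).comp
          (Polynomial.dickson 1 1 d) := by
  have ha : a1 ≠ 0 := left_ne_zero_of_mul hab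
  have hb : b1 ≠ 0 := right_ne_zero_of_mul hab
  obtain ⟨u, hu⟩ := IsAlgClosed.exists_pow_nat_eq (a1 * b1⁻¹) two_pos
  have hu0 : u ≠ 0 := by
    rintro rfl
    exact mul_ne_zero ha (inv_ne_zero hb) (by simpa using hu.symm)
  have hub : b1 * u = a1 * u⁻¹ := by
    field_simp at hu ⊢
    linear_combination hu
  have key : ∀ z : AlgebraicClosure ℚ, z ≠ 0 → f.eval (a1 * u⁻¹ * (z + z⁻¹) + c1) =
      a2 * u⁻¹ ^ d * z ^ d + b2 * u ^ d * z⁻¹ ^ d + c2 := by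
    intro z hz
    have hy := LaurentPolynomial.eval_trinomial_of_aeval_eq (by omega) h
      (mul_ne_zero (inv_ne_zero hu0) hz)
    rw [show a1 * u⁻¹ * (z + z⁻¹) + c1 = a1 * (u⁻¹ * z) + b1 * (u⁻¹ * z)⁻¹ + c1 by
      rw [mul_inv, inv_inv]
      linear_combination -z⁻¹ * hub, hy, mul_pow, mul_inv, ← inv_pow, ← inv_pow, inv_inv]
    ring
  have hcoeff : b2 * u ^ d = a2 * u⁻¹ ^ d := by
    have h₁ := key 2 two_ne_zero
    have h₂ := key 2⁻¹ (inv_ne_zero two_ne_zero)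
    rw [inv_inv, add_comm (2⁻¹ : AlgebraicClosure ℚ) 2, h₁] at h₂
    have hne : (2 : AlgebraicClosure ℚ) ^ d - 2⁻¹ ^ d ≠ 0 := by
      rw [sub_ne_zero, inv_pow, Ne, ← mul_eq_one_iff_eq_inv₀ (pow_ne_zero d two_ne_zero), ← pow_add]
      exact_mod_cast (Nat.one_lt_two_pow (by omega : d + d ≠ 0)).ne'
    refine sub_eq_zero.1 ((mul_eq_zero.1 ?_).resolve_right hne)
    linear_combination -h₂
  refine ⟨u, hu, Polynomial.eq_of_eval_add_inv_eq fun z hz => ?_⟩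
  have hD := Polynomial.dickson_one_one_eval_add_inv z z⁻¹ (mul_inv_cancel₀ hz) d
  simp only [Polynomial.eval_comp, Polynomial.eval_add, Polynomial.eval_mul,
    Polynomial.eval_C, Polynomial.eval_X] at hD ⊢
  rw [hD, key z hz, hcoeff]
  ring
end

section
/- Let f ∈ ℚ̄[X] have degree d ≥ 1, let m ≥ 1 be an integer, and suppose S(X) = a_1X^{m} + c_1 with a_1 ≠ 0 is such that f(S(X)) = a_2X^{dm} + b_2X^{−dm} + c_2 as Laurent polynomials over ℚ̄. Then b_2 = 0 and f(a_1X + c_1) = a_2X^{d} + c_2, i.e. f ∘ L = L' ∘ X^d with the linear polynomials L(X) = a_1X + c_1 and L'(X) = a_2X + c_2. -/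
/-- Substituting a polynomial in `T ^ m` into `f` gives the image in the Laurent polynomials of a
polynomial in `X ^ m`. -/
theorem LaurentPolynomial.aeval_C_mul_T_add_C {R : Type*} [CommSemiring R] (f : Polynomial R)
    (m : ℕ) (a c : R) :
    Polynomial.aeval (C a * T (m : ℤ) + C c) f =
      Polynomial.toLaurent
        (Polynomial.expand R m (f.comp (Polynomial.C a * Polynomial.X + Polynomial.C c))) := by
  have hS : (C a * T (m : ℤ) + C c : LaurentPolynomial R) =
      Polynomial.toLaurentAlg
        (Polynomial.expand R m (Polynomial.C a * Polynomial.X + Polynomial.C c)) := by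
    simp [Polynomial.toLaurentAlg_apply]
  rw [hS, Polynomial.aeval_algHom_apply, Polynomial.toLaurentAlg_apply,
    Polynomial.aeval_algHom_apply, Polynomial.comp_eq_aeval]

/-- If a Laurent polynomial `a T ^ n + b T ^ (-n) + c` with `n > 0` is a polynomial, then it is
`a X ^ n + c`, and `b = 0`. -/
theorem LaurentPolynomial.eq_of_toLaurent_eq_add_T_neg {R : Type*} [CommRing R] {g : Polynomial R}
    {n : ℕ} (hn : 0 < n) {a b c : R}
    (h : Polynomial.toLaurent g = C a * T (n : ℤ) + C b * T (-(n : ℤ)) + C c) :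
    b = 0 ∧ g = Polynomial.C a * Polynomial.X ^ n + Polynomial.C c := by
  have hg : g = Polynomial.C a * Polynomial.X ^ n + Polynomial.C c := by
    have ht := congrArg trunc h
    have hc : trunc (C c) = Polynomial.C c := by
      rw [← Polynomial.toLaurent_C, Polynomial.trunc_toLaurent]
    have hneg : ¬ (0 : ℤ) ≤ -(n : ℤ) := by lia
    rw [Polynomial.trunc_toLaurent, map_add, map_add, hc, trunc_C_mul_T, trunc_C_mul_T,
      if_pos n.cast_nonneg, if_neg hneg, add_zero, Int.toNat_natCast] at ht
    rw [ht, Polynomial.C_mul_X_pow_eq_monomial]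
  refine ⟨?_, hg⟩
  rw [hg, map_add, Polynomial.toLaurent_C_mul_X_pow, Polynomial.toLaurent_C, add_right_cancel_iff,
    left_eq_add, (isUnit_T _).mul_left_eq_zero, ← Polynomial.toLaurent_C,
    Polynomial.toLaurent_eq_zero, Polynomial.C_eq_zero] at h
  exact h

/-- If `f ∈ ℚ̄[X]` has degree `d ≥ 1`, `a₁ ≠ 0`, and
`f(a₁X^m + c₁) = a₂X^{dm} + b₂X^{-dm} + c₂` as Laurent polynomials, then `b₂ = 0` and
`f(a₁X + c₁) = a₂X^d + c₂`, i.e. `f ∘ L = L' ∘ X^d` with `L(X) = a₁X + c₁`,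
`L'(X) = a₂X + c₂`. -/
theorem statement_13
    (f : Polynomial (AlgebraicClosure ℚ)) (d : ℕ) (hd : 1 ≤ d) (hdf : f.natDegree = d)
    (m : ℕ) (hm : 1 ≤ m)
    (a1 c1 a2 b2 c2 : AlgebraicClosure ℚ) (ha1 : a1 ≠ 0)
    (h : Polynomial.aeval
        (LaurentPolynomial.C a1 * LaurentPolynomial.T (m : ℤ) +
          LaurentPolynomial.C c1) f =
      LaurentPolynomial.C a2 * LaurentPolynomial.T ((d * m : ℕ) : ℤ) +
        LaurentPolynomial.C b2 * LaurentPolynomial.T (-((d * m : ℕ) : ℤ)) +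
        LaurentPolynomial.C c2) :
    b2 = 0 ∧
      f.comp (Polynomial.C a1 * Polynomial.X + Polynomial.C c1) =
        Polynomial.C a2 * Polynomial.X ^ d + Polynomial.C c2 := by
  rw [LaurentPolynomial.aeval_C_mul_T_add_C] at h
  obtain ⟨hb, hg⟩ := LaurentPolynomial.eq_of_toLaurent_eq_add_T_neg (Nat.mul_pos hd hm) h
  refine ⟨hb, Polynomial.expand_injective hm ?_⟩
  rw [hg]
  simp [← pow_mul, mul_comm m d]
end

section
/- Let f_1,…,f_s ∈ K[X] with f_i = Σ_{j=0}^{d} a_{i,j}X^{j} all of the same degree d ≥ 3, and let |·|_v be a non-archimedean absolute value of K extended to ℚ̄. Suppose α ∈ ℚ̄ satisfies |α|_v > max over i = 1,…,s and j = 0,…,d−1 of { |a_{i,j}|_v |a_{i,d}|_v^{−1}, |a_{i,d}|_v^{−1}, |a_{i,d}|_v }. Then for every n ≥ 1 and all indices i_1,…,i_n ∈ {1,…,s}: (i) |f_{i_1…i_n}(α)|_v = |a_{i_n,d}|_v · |a_{i_{n−1},d}|_v^{d} ⋯ |a_{i_1,d}|_v^{d^{n−1}} · |α|_v^{d^{n}};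 and (ii) for every k < n and all indices j_1,…,j_k ∈ {1,…,s}, |f_{i_1…i_n}(α)|_v > |f_{j_1…j_k}(α)|_v. -/
open Polynomial

/-- If the leading term of `p` strictly dominates the other coefficients at `β`, the value of
`p` at `β` has the size of its leading term. -/
lemma IsNonarchimedean.apply_eval_eq_of_dominant {F : Type*} [Field F] {v : AbsoluteValue F ℝ}
    (hv : IsNonarchimedean ⇑v) {p : Polynomial F} {d : ℕ} (hdeg : p.natDegree = d) {β : F}
    (hβ : 1 ≤ v β) (h : ∀ j < d, v (p.coeff j) < v (p.coeff d) * v β) :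
    v (p.eval β) = v (p.coeff d) * v β ^ d := by
  rw [eval_eq_sum_range, hdeg,
    hv.apply_sum_eq_of_lt (fun a ↦ (v.map_neg a).symm) (k := d) (by simp)]
  · simp
  intro j hj hne
  have hjd : j < d := lt_of_le_of_ne (Nat.lt_succ_iff.mp (Finset.mem_range.mp hj)) hne
  have hβ0 : 0 < v β := one_pos.trans_le hβ
  simp only [map_mul, map_pow]
  calc v (p.coeff j) * v β ^ j < v (p.coeff d) * v β * v β ^ j := by
        gcongr
        exact h j hjd
    _ = v (p.coeff d) * v β ^ (j + 1) := by ring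
    _ ≤ v (p.coeff d) * v β ^ d := by
        gcongr
        exact hjd

lemma eval_compWord_cons {s : ℕ} (f : Fin s → Polynomial ℂ) (i : Fin s) (w : List (Fin s))
    (β : ℂ) : (compWord f (i :: w)).eval β = (compWord f w).eval ((f i).eval β) := by
  simp [compWord, eval_comp]

section Orbit

variable {s : ℕ} {f : Fin s → Polynomial ℂ} {d : ℕ} {v : AbsoluteValue ℂ ℝ} {A : ℝ}

lemma le_apply_eval_of_step (hd : 2 ≤ d) (hA : 1 ≤ A)
    (hlow : ∀ i, 1 ≤ v ((f i).coeff d) * A)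
    (hstep : ∀ i β, A ≤ v β → v ((f i).eval β) = v ((f i).coeff d) * v β ^ d)
    (i : Fin s) {β : ℂ} (hβ : A ≤ v β) : A ≤ v ((f i).eval β) := by
  rw [hstep i β hβ]
  calc A ≤ v ((f i).coeff d) * A * A := le_mul_of_one_le_left (by positivity) (hlow i)
    _ = v ((f i).coeff d) * A ^ 2 := by ring
    _ ≤ v ((f i).coeff d) * v β ^ d := by
        gcongr
        exact (pow_le_pow_right₀ hA hd).trans (by gcongr)

lemma apply_eval_compWord
    (hstep : ∀ i β, A ≤ v β → v ((f i).eval β) = v ((f i).coeff d) * v β ^ d)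
    (hinv : ∀ i β, A ≤ v β → A ≤ v ((f i).eval β)) (w : List (Fin s)) :
    ∀ β, A ≤ v β → v ((compWord f w).eval β) =
      (∏ t : Fin w.length, v ((f (w.get t)).coeff d) ^ d ^ (w.length - 1 - (t : ℕ))) *
        v β ^ d ^ w.length := by
  induction w with
  | nil => simp [compWord]
  | cons i w ih =>
    intro β hβ
    rw [eval_compWord_cons, ih _ (hinv i β hβ), hstep i β hβ]
    simp only [List.length_cons, Fin.prod_univ_succ, List.get_eq_getElem, Fin.val_zero,
      List.getElem_cons_zero, Fin.val_succ, List.getElem_cons_succ, Nat.add_sub_cancel,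
      Nat.sub_zero]
    have hexp : ∀ t : Fin w.length, w.length - ((t : ℕ) + 1) = w.length - 1 - t := by omega
    simp only [hexp]
    rw [mul_pow, ← pow_mul, ← pow_succ']
    ring

lemma apply_eval_compWord_upper (hA : 0 ≤ A) (hd : 1 ≤ d)
    (hup : ∀ i, v ((f i).coeff d) ≤ A)
    (hstep : ∀ i β, A ≤ v β → v ((f i).eval β) = v ((f i).coeff d) * v β ^ d)
    (hinv : ∀ i β, A ≤ v β → A ≤ v ((f i).eval β)) (w : List (Fin s)) :
    ∀ β, A ≤ v β →
      v ((compWord f w).eval β) ^ (d - 1) * A ≤ (v β ^ (d - 1) * A) ^ d ^ w.length := by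
  obtain ⟨e, rfl⟩ := Nat.exists_eq_add_of_le' hd
  induction w with
  | nil => simp [compWord]
  | cons i w ih =>
    intro β hβ
    rw [eval_compWord_cons]
    refine (ih _ (hinv i β hβ)).trans ?_
    rw [hstep i β hβ, List.length_cons, pow_succ' (e + 1) w.length, pow_mul]
    refine pow_le_pow_left₀ (by positivity) ?_ _
    calc (v ((f i).coeff (e + 1)) * v β ^ (e + 1)) ^ (e + 1 - 1) * A
        ≤ (A * v β ^ (e + 1)) ^ (e + 1 - 1) * A := by
          gcongr
          exact hup i
      _ = (v β ^ (e + 1 - 1) * A) ^ (e + 1) := by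
          simp only [Nat.add_sub_cancel]
          ring

lemma apply_eval_compWord_lower (hA : 0 ≤ A) (hd : 1 ≤ d)
    (hlow : ∀ i, 1 ≤ v ((f i).coeff d) * A)
    (hstep : ∀ i β, A ≤ v β → v ((f i).eval β) = v ((f i).coeff d) * v β ^ d)
    (hinv : ∀ i β, A ≤ v β → A ≤ v ((f i).eval β)) (w : List (Fin s)) :
    ∀ β, A ≤ v β →
      (v β ^ (d - 1)) ^ d ^ w.length * A ≤
        v ((compWord f w).eval β) ^ (d - 1) * A ^ d ^ w.length := by
  obtain ⟨e, rfl⟩ := Nat.exists_eq_add_of_le' hd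
  simp only [Nat.add_sub_cancel]
  induction w with
  | nil => simp [compWord]
  | cons i w ih =>
    intro β hβ
    have h := ih _ (hinv i β hβ)
    rw [eval_compWord_cons]
    set V := v ((compWord f w).eval ((f i).eval β))
    rw [hstep i β hβ] at h
    rw [List.length_cons, pow_succ' (e + 1) w.length, pow_mul, pow_mul]
    set N := (e + 1) ^ w.length
    have key : (v β ^ e) ^ (e + 1) ≤ (v ((f i).coeff (e + 1)) * v β ^ (e + 1)) ^ e * A ^ e := by
      calc (v β ^ e) ^ (e + 1) = 1 ^ e * (v β ^ e) ^ (e + 1) := by simp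
        _ ≤ (v ((f i).coeff (e + 1)) * A) ^ e * (v β ^ e) ^ (e + 1) := by
            gcongr
            exact hlow i
        _ = _ := by ring
    calc ((v β ^ e) ^ (e + 1)) ^ N * A
        ≤ ((v ((f i).coeff (e + 1)) * v β ^ (e + 1)) ^ e * A ^ e) ^ N * A := by gcongr
      _ = ((v ((f i).coeff (e + 1)) * v β ^ (e + 1)) ^ e) ^ N * A * (A ^ e) ^ N := by ring
      _ ≤ V ^ e * A ^ N * (A ^ e) ^ N := by gcongr
      _ = V ^ e * (A ^ (e + 1)) ^ N := by ring

end Orbit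

/-- Let `f_1,…,f_s ∈ K[X]` all have degree `d ≥ 3` and let `|·|_v` be a
non-archimedean absolute value of `K` extended to `ℚ̄`.  If `|α|_v` exceeds
`|a_{i,j}|_v |a_{i,d}|_v⁻¹` (`j < d`), `|a_{i,d}|_v⁻¹` and `|a_{i,d}|_v` for all `i`, then
for all `n ≥ 1` and indices `i₁,…,i_n`:
(i) `|f_{i₁…i_n}(α)|_v = |a_{i_n,d}|_v |a_{i_{n-1},d}|_v^d ⋯ |a_{i₁,d}|_v^{d^{n-1}} |α|_v^{dⁿ}`;
(ii) `|f_{i₁…i_n}(α)|_v > |f_{j₁…j_k}(α)|_v` for every `k < n` and all indices `j₁,…,j_k`. -/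
theorem statement_16 (K : Subfield ℂ) [FiniteDimensional ℚ K]
    {s : ℕ} (f : Fin s → Polynomial ℂ)
    (hcoeff : ∀ i n, (f i).coeff n ∈ K)
    (d : ℕ) (hd : 3 ≤ d) (hdeg : ∀ i, (f i).natDegree = d)
    (v : AbsoluteValue ℂ ℝ) (hv : IsNonarchimedean ⇑v)
    (α : ℂ) (halg : IsAlgebraic ℚ α)
    (h1 : ∀ i, ∀ j < d, v ((f i).coeff j) * (v ((f i).coeff d))⁻¹ < v α)
    (h2 : ∀ i, (v ((f i).coeff d))⁻¹ < v α)
    (h3 : ∀ i, v ((f i).coeff d) < v α) :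
    ∀ w : List (Fin s), w ≠ [] →
      (v ((compWord f w).eval α) =
        (∏ t : Fin w.length,
          v ((f (w.get t)).coeff d) ^ d ^ (w.length - 1 - (t : ℕ))) *
          v α ^ d ^ w.length) ∧
      ∀ u : List (Fin s), u.length < w.length →
        v ((compWord f u).eval α) < v ((compWord f w).eval α) := by
  intro w hw
  have hc0 : ∀ i, 0 < v ((f i).coeff d) := fun i ↦ by
    refine v.pos ?_
    have hne : f i ≠ 0 := by
      rintro h
      have := hdeg i
      rw [h, natDegree_zero] at this
      omega
    rw [← hdeg i]
    exact leadingCoeff_ne_zero.mpr hne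
  have hlow : ∀ i, 1 < v ((f i).coeff d) * v α := fun i ↦
    (inv_lt_iff_one_lt_mul₀' (hc0 i)).mp (h2 i)
  have hA : 1 < v α := by
    by_contra! hle
    have := mul_le_one₀ ((h3 (w.head hw)).le.trans hle) (v.nonneg α) hle
    exact absurd (hlow (w.head hw)) this.not_gt
  have hstep : ∀ i β, v α ≤ v β → v ((f i).eval β) = v ((f i).coeff d) * v β ^ d :=
    fun i β hβ ↦ hv.apply_eval_eq_of_dominant (hdeg i) (hA.le.trans hβ) fun j hj ↦
      ((mul_inv_lt_iff₀' (hc0 i)).mp (h1 i j hj)).trans_le (by gcongr)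
  have hinv : ∀ i β, v α ≤ v β → v α ≤ v ((f i).eval β) := fun i β hβ ↦
    le_apply_eval_of_step (by omega) hA.le (fun i ↦ (hlow i).le) hstep i hβ
  refine ⟨apply_eval_compWord hstep hinv w α le_rfl, fun u hu ↦ ?_⟩
  have hup := apply_eval_compWord_upper (v.nonneg α) (by omega) (fun i ↦ (h3 i).le) hstep hinv u
    α le_rfl
  have hlo := apply_eval_compWord_lower (v.nonneg α) (by omega) (fun i ↦ (hlow i).le) hstep hinv w
    α le_rfl
  obtain ⟨e, rfl⟩ := Nat.exists_eq_add_of_le' hd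
  have hA0 : 0 < v α := one_pos.trans hA
  refine lt_of_pow_lt_pow_left₀ (e + 3 - 1) (v.nonneg _) ?_
  rw [← pow_succ, ← pow_mul] at hup
  have hle : v α ^ ((e + 3 - 1 + 1) * (e + 3) ^ u.length) ≤
      v α ^ ((e + 1) * (e + 3) ^ w.length) := by
    refine pow_le_pow_right₀ hA.le ?_
    calc (e + 3 - 1 + 1) * (e + 3) ^ u.length = (e + 3) ^ (u.length + 1) := by
          rw [pow_succ']; simp
      _ ≤ (e + 3) ^ w.length := Nat.pow_le_pow_right (by omega) hu
      _ ≤ (e + 1) * (e + 3) ^ w.length := Nat.le_mul_of_pos_left _ (by omega)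
  have hlo' : v α ^ ((e + 1) * (e + 3) ^ w.length) * v α ≤
      v ((compWord f w).eval α) ^ (e + 3 - 1) := by
    refine le_of_mul_le_mul_right ?_ (pow_pos hA0 ((e + 3) ^ w.length))
    refine le_trans (le_of_eq ?_) hlo
    rw [show e + 3 - 1 = e + 1 + 1 by omega]
    ring
  calc v ((compWord f u).eval α) ^ (e + 3 - 1)
      ≤ v ((compWord f u).eval α) ^ (e + 3 - 1) * v α :=
        le_mul_of_one_le_right (by positivity) hA.le
    _ ≤ v α ^ ((e + 1) * (e + 3) ^ w.length) := hup.trans hle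
    _ < v α ^ ((e + 1) * (e + 3) ^ w.length) * v α := lt_mul_of_one_lt_right (by positivity) hA
    _ ≤ _ := hlo'
end
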